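/- Let D be an operator in the Weyl algebra A₂. Then D satisfies D(φ(|z|²) ξ_m(z)) = ξ_m(z) · (T_m φ)(|z|²) for all m ∈ ℤ and all polynomials φ ∈ ℂ[x], relative to some family {T_m}_{m ∈ ℤ} of operators in the first Weyl algebra A₁, if and only if D commutes with rotations. -/

import Mathlib

open MvPolynomial

noncomputable section

/-- The polynomial ring ℂ[z, z̄]; `X 0` is `z` and `X 1` is `z̄`. -/
abbrev P2 : Type := MvPolynomial (Fin 2) ℂ

/-- Multiplication by `z`. -/
def Mz : Module.End ℂ P2 := LinearMap.mulLeft ℂ (X 0 : P2)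
/-- Multiplication by `z̄`. -/
def Mzbar : Module.End ℂ P2 := LinearMap.mulLeft ℂ (X 1 : P2)
/-- Formal `∂/∂z`. -/
def Dz : Module.End ℂ P2 := (pderiv (0 : Fin 2)).toLinearMap
/-- Formal `∂/∂z̄`. -/
def Dzbar : Module.End ℂ P2 := (pderiv (1 : Fin 2)).toLinearMap

/-- Rotation operator `R_θ : p(z, z̄) ↦ p(e^{iθ} z, e^{-iθ} z̄)`. -/
def rot (θ : ℝ) : Module.End ℂ P2 :=
  (aeval (fun i : Fin 2 => if i = 0 then (Complex.exp (θ * Complex.I)) • (X 0 : P2)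
    else (Complex.exp (-(θ * Complex.I))) • (X 1 : P2))).toLinearMap

/-- `D` commutes with rotations: `D ∘ R_θ = R_θ ∘ D` for all `θ ∈ [0, 2π)`. -/
def CommutesWithRotations (D : Module.End ℂ P2) : Prop :=
  ∀ θ : ℝ, 0 ≤ θ → θ < 2 * Real.pi → D * rot θ = rot θ * D

/-- The second Weyl algebra `A₂`, as a subalgebra of `End ℂ (ℂ[z, z̄])`. -/
def WeylA2 : Subalgebra ℂ (Module.End ℂ P2) :=
  Algebra.adjoin ℂ {Mz, Mzbar, Dz, Dzbar}

/-- Canonical basis element `z^{a1} z̄^{b1} ∂^{a2} ∂̄^{b2}` of `A₂`. -/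
def canB (a1 b1 a2 b2 : ℕ) : Module.End ℂ P2 :=
  Mz ^ a1 * Mzbar ^ b1 * Dz ^ a2 * Dzbar ^ b2

/-- `ξ_m(z) = z^m` for `m ≥ 0`, and `ξ_m(z) = z̄^{|m|}` for `m < 0`. -/
def xi (m : ℤ) : P2 := if 0 ≤ m then (X 0 : P2) ^ m.toNat else (X 1 : P2) ^ m.natAbs

/-- Evaluation of a one-variable polynomial `φ ∈ ℂ[x]` at `|z|² = z z̄`,
giving `φ(|z|²) ∈ ℂ[z, z̄]`. -/
def evalZZ : Polynomial ℂ →ₐ[ℂ] P2 := Polynomial.aeval (X 0 * X 1 : P2)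

/-- Multiplication by `x` on ℂ[x]. -/
def Mx : Module.End ℂ (Polynomial ℂ) := LinearMap.mulLeft ℂ (Polynomial.X : Polynomial ℂ)

/-- The formal derivative `d/dx` on ℂ[x]. -/
def Dx : Module.End ℂ (Polynomial ℂ) := Polynomial.derivative

/-- The first Weyl algebra `A₁`, generated by `x` and `d/dx`. -/
def WeylA1 : Subalgebra ℂ (Module.End ℂ (Polynomial ℂ)) :=
  Algebra.adjoin ℂ {Mx, Dx}

theorem xi_natCast (k : ℕ) : xi (k : ℤ) = X 0 ^ k := by
  simp [xi]

theorem xi_neg_natCast (k : ℕ) : xi (-(k : ℤ)) = X 1 ^ k := by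
  rcases Nat.eq_zero_or_pos k with rfl | hk
  · simp [xi]
  · have : ¬ (0 : ℤ) ≤ -(k : ℤ) := by omega
    simp only [xi, if_neg this, Int.natAbs_neg, Int.natAbs_natCast]

/-- The embedding `φ ↦ φ(|z|²) ξ_m` of `ℂ[x]` as the weight `m` part of `ℂ[z, z̄]`. -/
def weightEmbedding (m : ℤ) : Polynomial ℂ →ₗ[ℂ] P2 :=
  LinearMap.mulRight ℂ (xi m) ∘ₗ evalZZ.toLinearMap

@[simp]
theorem weightEmbedding_apply (m : ℤ) (φ : Polynomial ℂ) :
    weightEmbedding m φ = evalZZ φ * xi m := rfl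

/-- The rotation weights of `z` and `z̄`. -/
def rotWeight : Fin 2 → ℤ := ![1, -1]

theorem weight_rotWeight (d : Fin 2 →₀ ℕ) :
    Finsupp.weight rotWeight d = (d 0 : ℤ) - d 1 := by
  simp [Finsupp.weight_apply, Finsupp.sum_fintype, rotWeight, sub_eq_add_neg]

theorem isWeightedHomogeneous_xi (m : ℤ) : IsWeightedHomogeneous rotWeight (xi m) m := by
  obtain ⟨k, rfl | rfl⟩ := m.eq_nat_or_neg
  · rw [xi_natCast]
    simpa [rotWeight] using (isWeightedHomogeneous_X ℂ rotWeight 0).pow k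
  · rw [xi_neg_natCast]
    simpa [rotWeight] using (isWeightedHomogeneous_X ℂ rotWeight 1).pow k

theorem isWeightedHomogeneous_evalZZ (φ : Polynomial ℂ) :
    IsWeightedHomogeneous rotWeight (evalZZ φ) 0 := by
  induction φ using Polynomial.induction_on' with
  | add p q hp hq => rw [map_add]; exact hp.add hq
  | monomial n a =>
    have h := (isWeightedHomogeneous_C rotWeight a).mul
      (((isWeightedHomogeneous_X ℂ rotWeight 0).mul
        (isWeightedHomogeneous_X ℂ rotWeight 1)).pow n)
    simpa [evalZZ, Polynomial.aeval_monomial, rotWeight, algebraMap_eq] using h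

theorem isWeightedHomogeneous_weightEmbedding (m : ℤ) (φ : Polynomial ℂ) :
    IsWeightedHomogeneous rotWeight (weightEmbedding m φ) m := by
  simpa using (isWeightedHomogeneous_evalZZ φ).mul (isWeightedHomogeneous_xi m)

theorem rot_monomial (θ : ℝ) (d : Fin 2 →₀ ℕ) (c : ℂ) :
    rot θ (monomial d c) =
      Complex.exp (Finsupp.weight rotWeight d * (θ * Complex.I)) • monomial d c := by
  have h : Complex.exp (Finsupp.weight rotWeight d * (θ * Complex.I)) =
      Complex.exp (θ * Complex.I) ^ d 0 * Complex.exp (-(θ * Complex.I)) ^ d 1 := by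
    rw [← Complex.exp_nat_mul, ← Complex.exp_nat_mul, ← Complex.exp_add, weight_rotWeight]
    congr 1
    push_cast
    ring
  rw [h, monomial_eq]
  simp only [rot, AlgHom.toLinearMap_apply, map_mul, Finsupp.prod_fintype, pow_zero,
    implies_true, Fin.prod_univ_two, map_pow, aeval_X, aeval_C, algebraMap_eq, smul_eq_C_mul,
    if_true, one_ne_zero, if_false]
  ring

theorem coeff_rot (θ : ℝ) (d : Fin 2 →₀ ℕ) (p : P2) :
    coeff d (rot θ p) =
      Complex.exp (Finsupp.weight rotWeight d * (θ * Complex.I)) * coeff d p := by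
  induction p using MvPolynomial.induction_on' with
  | add p q hp hq => rw [map_add, coeff_add, hp, hq, coeff_add, mul_add]
  | monomial e c =>
    rw [rot_monomial, coeff_smul, coeff_monomial, smul_eq_mul]
    split_ifs with h
    · rw [h]
    · simp

theorem rot_eq_smul_of_isWeightedHomogeneous {p : P2} {m : ℤ}
    (hp : IsWeightedHomogeneous rotWeight p m) (θ : ℝ) :
    rot θ p = Complex.exp (m * (θ * Complex.I)) • p := by
  ext d
  rw [coeff_rot, coeff_smul, smul_eq_mul]
  by_cases h : coeff d p = 0
  · simp [h]
  · rw [hp h]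

theorem isWeightedHomogeneous_of_rot_one_eq_smul {p : P2} {m : ℤ}
    (hp : rot 1 p = Complex.exp (m * ((1 : ℝ) * Complex.I)) • p) :
    IsWeightedHomogeneous rotWeight p m := by
  intro d hd
  have h := congrArg (coeff d) hp
  rw [coeff_rot, coeff_smul, smul_eq_mul] at h
  obtain ⟨n, hn⟩ := Complex.exp_eq_exp_iff_exists_int.mp (mul_right_cancel₀ hd h)
  have hr : ((Finsupp.weight rotWeight d : ℤ) : ℝ) = m + n * (2 * Real.pi) := by
    have := congrArg Complex.im hn
    simpa using this
  by_cases hn0 : n = 0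
  · subst hn0
    exact_mod_cast (by simpa using hr : ((Finsupp.weight rotWeight d : ℤ) : ℝ) = m)
  · refine absurd ?_ ((irrational_pi.intCast_mul (m := 2 * n) (by omega)).ne_int
      (Finsupp.weight rotWeight d - m))
    push_cast
    rw [hr]
    ring

theorem exists_weightEmbedding_eq_monomial (d : Fin 2 →₀ ℕ) :
    ∃ (m : ℤ) (φ : Polynomial ℂ), weightEmbedding m φ = monomial d 1 := by
  have hd : (monomial d (1 : ℂ)) = X 0 ^ d 0 * X 1 ^ d 1 := by
    rw [monomial_eq]
    simp [Finsupp.prod_fintype]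
  rcases le_total (d 1) (d 0) with h | h
  · obtain ⟨k, hk⟩ := Nat.exists_eq_add_of_le h
    refine ⟨k, Polynomial.X ^ d 1, ?_⟩
    rw [hd, weightEmbedding_apply, xi_natCast, hk]
    simp only [evalZZ, map_pow, Polynomial.aeval_X]
    ring
  · obtain ⟨k, hk⟩ := Nat.exists_eq_add_of_le h
    refine ⟨-k, Polynomial.X ^ d 0, ?_⟩
    rw [hd, weightEmbedding_apply, xi_neg_natCast, hk]
    simp only [evalZZ, map_pow, Polynomial.aeval_X]
    ring

theorem pderiv_evalZZ_zero (φ : Polynomial ℂ) :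
    pderiv 0 (evalZZ φ) = evalZZ (Polynomial.derivative φ) * X 1 := by
  simp [evalZZ, Derivation.map_aeval, pderiv_X]

theorem pderiv_evalZZ_one (φ : Polynomial ℂ) :
    pderiv 1 (evalZZ φ) = evalZZ (Polynomial.derivative φ) * X 0 := by
  simp [evalZZ, Derivation.map_aeval, pderiv_X]

/-- The span of the maps `φ ↦ (T φ)(|z|²) ξ_n` with `n ∈ ℤ` and `T ∈ A₁`. -/
def weylSpan : Submodule ℂ (Polynomial ℂ →ₗ[ℂ] P2) :=
  Submodule.span ℂ {f | ∃ n : ℤ, ∃ T ∈ WeylA1, f = weightEmbedding n ∘ₗ T}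

theorem weightEmbedding_comp_mem_weylSpan (n : ℤ) {T : Module.End ℂ (Polynomial ℂ)}
    (hT : T ∈ WeylA1) : weightEmbedding n ∘ₗ T ∈ weylSpan :=
  Submodule.subset_span ⟨n, T, hT, rfl⟩

theorem weightEmbedding_mem_weylSpan (n : ℤ) : weightEmbedding n ∈ weylSpan := by
  have h := weightEmbedding_comp_mem_weylSpan n (one_mem WeylA1)
  rwa [Module.End.one_eq_id, LinearMap.comp_id] at h

theorem comp_mem_weylSpan {f : Polynomial ℂ →ₗ[ℂ] P2} (hf : f ∈ weylSpan)
    {T : Module.End ℂ (Polynomial ℂ)} (hT : T ∈ WeylA1) : f ∘ₗ T ∈ weylSpan := by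
  induction hf using Submodule.span_induction with
  | mem f hf =>
    obtain ⟨n, S, hS, rfl⟩ := hf
    have h := weightEmbedding_comp_mem_weylSpan n (mul_mem hS hT)
    rwa [Module.End.mul_eq_comp, ← LinearMap.comp_assoc] at h
  | zero => rw [LinearMap.zero_comp]; exact zero_mem _
  | add f g _ _ hf hg => rw [LinearMap.add_comp]; exact add_mem hf hg
  | smul c f _ hf => rw [LinearMap.smul_comp]; exact Submodule.smul_mem _ c hf

theorem Mx_mem_WeylA1 : Mx ∈ WeylA1 := Algebra.subset_adjoin (by simp)

theorem Dx_mem_WeylA1 : Dx ∈ WeylA1 := Algebra.subset_adjoin (by simp)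

/-- The operator `x d/dx + c` of `A₁`. -/
def shiftedEuler (c : ℂ) : Module.End ℂ (Polynomial ℂ) := Mx * Dx + algebraMap ℂ _ c

theorem shiftedEuler_mem_WeylA1 (c : ℂ) : shiftedEuler c ∈ WeylA1 :=
  add_mem (mul_mem Mx_mem_WeylA1 Dx_mem_WeylA1) (algebraMap_mem _ c)

theorem evalZZ_Mx (φ : Polynomial ℂ) : evalZZ (Mx φ) = X 0 * X 1 * evalZZ φ := by
  simp [evalZZ, Mx]

theorem evalZZ_shiftedEuler (c : ℂ) (φ : Polynomial ℂ) :
    evalZZ (shiftedEuler c φ) =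
      X 0 * X 1 * evalZZ (Polynomial.derivative φ) + C c * evalZZ φ := by
  rw [← smul_eq_C_mul, ← map_smul, ← evalZZ_Mx, ← map_add]
  rfl

theorem Mz_comp_weightEmbedding_mem (m : ℤ) : Mz ∘ₗ weightEmbedding m ∈ weylSpan := by
  obtain ⟨k, rfl | rfl⟩ := m.eq_nat_or_neg
  · convert weightEmbedding_mem_weylSpan ((k + 1 : ℕ) : ℤ) using 1
    refine LinearMap.ext fun φ => ?_
    simp only [LinearMap.comp_apply, weightEmbedding_apply, xi_natCast, Mz,
      LinearMap.mulLeft_apply]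
    ring
  · cases k with
    | zero =>
      convert weightEmbedding_mem_weylSpan ((1 : ℕ) : ℤ) using 1
      refine LinearMap.ext fun φ => ?_
      simp only [LinearMap.comp_apply, weightEmbedding_apply, xi_natCast, xi_neg_natCast, Mz,
        LinearMap.mulLeft_apply]
      ring
    | succ k =>
      convert weightEmbedding_comp_mem_weylSpan (-(k : ℤ)) Mx_mem_WeylA1 using 1
      refine LinearMap.ext fun φ => ?_
      simp only [LinearMap.comp_apply, weightEmbedding_apply, xi_neg_natCast, Mz,
        LinearMap.mulLeft_apply, evalZZ_Mx]
      ring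

theorem Mzbar_comp_weightEmbedding_mem (m : ℤ) : Mzbar ∘ₗ weightEmbedding m ∈ weylSpan := by
  obtain ⟨k, rfl | rfl⟩ := m.eq_nat_or_neg
  · cases k with
    | zero =>
      convert weightEmbedding_mem_weylSpan (-((1 : ℕ) : ℤ)) using 1
      refine LinearMap.ext fun φ => ?_
      simp only [LinearMap.comp_apply, weightEmbedding_apply, xi_natCast, xi_neg_natCast, Mzbar,
        LinearMap.mulLeft_apply]
      ring
    | succ k =>
      convert weightEmbedding_comp_mem_weylSpan (k : ℤ) Mx_mem_WeylA1 using 1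
      refine LinearMap.ext fun φ => ?_
      simp only [LinearMap.comp_apply, weightEmbedding_apply, xi_natCast, Mzbar,
        LinearMap.mulLeft_apply, evalZZ_Mx]
      ring
  · convert weightEmbedding_mem_weylSpan (-((k + 1 : ℕ) : ℤ)) using 1
    refine LinearMap.ext fun φ => ?_
    simp only [LinearMap.comp_apply, weightEmbedding_apply, xi_neg_natCast, Mzbar,
      LinearMap.mulLeft_apply]
    ring

theorem Dz_comp_weightEmbedding_mem (m : ℤ) : Dz ∘ₗ weightEmbedding m ∈ weylSpan := by
  obtain ⟨k, rfl | rfl⟩ := m.eq_nat_or_neg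
  · cases k with
    | zero =>
      convert weightEmbedding_comp_mem_weylSpan (-((1 : ℕ) : ℤ)) Dx_mem_WeylA1 using 1
      refine LinearMap.ext fun φ => ?_
      simp only [LinearMap.comp_apply, weightEmbedding_apply, xi_natCast, xi_neg_natCast, Dz,
        Dx, Derivation.coeFn_coe, pow_zero, mul_one, pow_one, pderiv_evalZZ_zero]
    | succ k =>
      convert weightEmbedding_comp_mem_weylSpan (k : ℤ)
        (shiftedEuler_mem_WeylA1 ((k + 1 : ℕ) : ℂ)) using 1
      refine LinearMap.ext fun φ => ?_
      simp only [LinearMap.comp_apply, weightEmbedding_apply, xi_natCast, evalZZ_shiftedEuler,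
        Dz, Derivation.coeFn_coe, Derivation.leibniz, Derivation.leibniz_pow,
        pderiv_evalZZ_zero, pderiv_X_self, smul_eq_mul, nsmul_eq_mul, map_natCast,
        add_tsub_cancel_right]
      ring
  · convert weightEmbedding_comp_mem_weylSpan (-((k + 1 : ℕ) : ℤ)) Dx_mem_WeylA1 using 1
    refine LinearMap.ext fun φ => ?_
    simp only [LinearMap.comp_apply, weightEmbedding_apply, xi_neg_natCast, Dz, Dx,
      Derivation.coeFn_coe, Derivation.leibniz, Derivation.leibniz_pow, pderiv_evalZZ_zero,
      pderiv_X_of_ne (R := ℂ) (one_ne_zero : (1 : Fin 2) ≠ 0), smul_eq_mul]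
    ring

theorem Dzbar_comp_weightEmbedding_mem (m : ℤ) : Dzbar ∘ₗ weightEmbedding m ∈ weylSpan := by
  obtain ⟨k, rfl | rfl⟩ := m.eq_nat_or_neg
  · convert weightEmbedding_comp_mem_weylSpan ((k + 1 : ℕ) : ℤ) Dx_mem_WeylA1 using 1
    refine LinearMap.ext fun φ => ?_
    simp only [LinearMap.comp_apply, weightEmbedding_apply, xi_natCast, Dzbar, Dx,
      Derivation.coeFn_coe, Derivation.leibniz, Derivation.leibniz_pow, pderiv_evalZZ_one,
      pderiv_X_of_ne (R := ℂ) (zero_ne_one : (0 : Fin 2) ≠ 1), smul_eq_mul]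
    ring
  · cases k with
    | zero =>
      convert weightEmbedding_comp_mem_weylSpan ((1 : ℕ) : ℤ) Dx_mem_WeylA1 using 1
      refine LinearMap.ext fun φ => ?_
      simp only [LinearMap.comp_apply, weightEmbedding_apply, xi_natCast, xi_neg_natCast, Dzbar,
        Dx, Derivation.coeFn_coe, pow_zero, mul_one, pow_one, pderiv_evalZZ_one]
    | succ k =>
      convert weightEmbedding_comp_mem_weylSpan (-(k : ℤ))
        (shiftedEuler_mem_WeylA1 ((k + 1 : ℕ) : ℂ)) using 1
      refine LinearMap.ext fun φ => ?_
      simp only [LinearMap.comp_apply, weightEmbedding_apply, xi_neg_natCast,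
        evalZZ_shiftedEuler, Dzbar, Derivation.coeFn_coe, Derivation.leibniz,
        Derivation.leibniz_pow, pderiv_evalZZ_one, pderiv_X_self, smul_eq_mul, nsmul_eq_mul,
        map_natCast, add_tsub_cancel_right]
      ring

theorem comp_weightEmbedding_mem_weylSpan {D : Module.End ℂ P2} (hD : D ∈ WeylA2) :
    ∀ m : ℤ, D ∘ₗ weightEmbedding m ∈ weylSpan := by
  induction hD using Algebra.adjoin_induction with
  | mem D hD =>
    rcases hD with rfl | rfl | rfl | rfl
    · exact Mz_comp_weightEmbedding_mem
    · exact Mzbar_comp_weightEmbedding_mem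
    · exact Dz_comp_weightEmbedding_mem
    · exact Dzbar_comp_weightEmbedding_mem
  | algebraMap c =>
    intro m
    rw [Algebra.algebraMap_eq_smul_one, LinearMap.smul_comp, Module.End.one_eq_id,
      LinearMap.id_comp]
    exact Submodule.smul_mem _ c (weightEmbedding_mem_weylSpan m)
  | add D E _ _ hD hE =>
    intro m
    rw [LinearMap.add_comp]
    exact add_mem (hD m) (hE m)
  | mul D E _ _ hD hE =>
    intro m
    rw [Module.End.mul_eq_comp, LinearMap.comp_assoc]
    generalize E ∘ₗ weightEmbedding m = f, hE m = hf
    induction hf using Submodule.span_induction with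
    | mem f hf =>
      obtain ⟨n, T, hT, rfl⟩ := hf
      rw [← LinearMap.comp_assoc]
      exact comp_mem_weylSpan (hD n) hT
    | zero => rw [LinearMap.comp_zero]; exact zero_mem _
    | add f g _ _ hf hg => rw [LinearMap.comp_add]; exact add_mem hf hg
    | smul c f _ hf => rw [LinearMap.comp_smul]; exact Submodule.smul_mem _ c hf

theorem exists_weightedHomogeneousComponent_comp_eq {f : Polynomial ℂ →ₗ[ℂ] P2}
    (hf : f ∈ weylSpan) (m : ℤ) :
    ∃ T ∈ WeylA1, weightedHomogeneousComponent rotWeight m ∘ₗ f = weightEmbedding m ∘ₗ T := by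
  induction hf using Submodule.span_induction with
  | mem f hf =>
    obtain ⟨n, T, hT, rfl⟩ := hf
    by_cases h : n = m
    · subst h
      exact ⟨T, hT, LinearMap.ext fun φ =>
        (isWeightedHomogeneous_weightEmbedding n (T φ)).weightedHomogeneousComponent_same⟩
    · refine ⟨0, zero_mem _, LinearMap.ext fun φ => ?_⟩
      rw [LinearMap.comp_zero]
      exact (isWeightedHomogeneous_weightEmbedding n (T φ)).weightedHomogeneousComponent_ne m
        (Ne.symm h)
  | zero => exact ⟨0, zero_mem _, by simp⟩
  | add f g _ _ hf hg =>
    obtain ⟨S, hS, hf⟩ := hf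
    obtain ⟨T, hT, hg⟩ := hg
    exact ⟨S + T, add_mem hS hT, by rw [LinearMap.comp_add, LinearMap.comp_add, hf, hg]⟩
  | smul c f _ hf =>
    obtain ⟨T, hT, hf⟩ := hf
    exact ⟨c • T, WeylA1.smul_mem hT c, by rw [LinearMap.comp_smul, LinearMap.comp_smul, hf]⟩

/-- `D ∈ A₂` satisfies `D(φ(|z|²) ξ_m) = ξ_m (T_m φ)(|z|²)`
for all `m ∈ ℤ`, `φ ∈ ℂ[x]`, relative to some family `{T_m} ⊆ A₁`,
if and only if `D` commutes with rotations. -/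
theorem component_action_iff_commutesWithRotations (D : Module.End ℂ P2)
    (hD : D ∈ WeylA2) :
    (∃ T : ℤ → Module.End ℂ (Polynomial ℂ), (∀ m, T m ∈ WeylA1) ∧
      ∀ (m : ℤ) (φ : Polynomial ℂ), D (evalZZ φ * xi m) = xi m * evalZZ (T m φ)) ↔
    CommutesWithRotations D := by
  constructor
  · rintro ⟨T, -, hT⟩ θ - -
    refine (basisMonomials (Fin 2) ℂ).ext fun d => ?_
    rw [coe_basisMonomials]
    obtain ⟨m, φ, h⟩ := exists_weightEmbedding_eq_monomial d
    have hD : D (weightEmbedding m φ) = weightEmbedding m (T m φ) := by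
      rw [weightEmbedding_apply, hT, weightEmbedding_apply, mul_comm]
    have hrot := fun ψ => rot_eq_smul_of_isWeightedHomogeneous
      (isWeightedHomogeneous_weightEmbedding m ψ) θ
    simp only [Module.End.mul_apply, ← h, hrot, map_smul, hD]
  · intro hrot
    have key (m : ℤ) : ∃ T ∈ WeylA1, D ∘ₗ weightEmbedding m = weightEmbedding m ∘ₗ T := by
      obtain ⟨T, hT, h⟩ :=
        exists_weightedHomogeneousComponent_comp_eq (comp_weightEmbedding_mem_weylSpan hD m) m
      refine ⟨T, hT, h ▸ LinearMap.ext fun φ => ?_⟩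
      refine (isWeightedHomogeneous_of_rot_one_eq_smul
        ?_).weightedHomogeneousComponent_same.symm
      have hcomm := LinearMap.congr_fun
        (hrot 1 zero_le_one (by linarith [Real.pi_gt_three])) (weightEmbedding m φ)
      rw [Module.End.mul_apply, Module.End.mul_apply, rot_eq_smul_of_isWeightedHomogeneous
        (isWeightedHomogeneous_weightEmbedding m φ), map_smul] at hcomm
      exact hcomm.symm
    choose T hT h using key
    refine ⟨T, hT, fun m φ => ?_⟩
    rw [mul_comm (xi m)]
    exact LinearMap.congr_fun (h m) φ
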